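/- arXiv:2011.09511 — 2 statements merged into one kernel-verified Lean document; each statement's English description precedes it below -/
import Mathlib

section
/- Let x : U → ℝ³ be a wavefront, p ∈ Σ(x), and let Ω = Dy_l be a tmb of x on a neighborhood V of p, where l > 0 and y_l := x + l·n restricted to V is an embedding. Then rank(Dx(p)) = 0 if and only if y_l has an umbilical point at p with positive Gaussian curvature (equivalently K_l(p) = 1/l² and H_l(p) = −1/l); and rank(Dx(p)) = 1 if and only if y_l is free of umbilical points on some neighborhood of p. -/
/- Common framework for frontals and tangent moving bases, following
   "Curvatures on fronts" conventions. -/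

noncomputable section

open Matrix Topology Filter

/-- Points of the plane ℝ². -/
abbrev Pt : Type := Fin 2 → ℝ

/-- Jacobian matrix of a map `f : ℝ² → ℝ^m` at a point. -/
def jac {m : ℕ} (f : Pt → (Fin m → ℝ)) (p : Pt) : Matrix (Fin m) (Fin 2) ℝ :=
  Matrix.of fun i j => fderiv ℝ f p (Pi.single j 1) i

/-- Euclidean norm of a vector in ℝ³. -/
def enorm3 (v : Fin 3 → ℝ) : ℝ := Real.sqrt (v ⬝ᵥ v)

/-- The unit normal vector field induced by a tangent moving base `Ω`,
    `n := (w₁ × w₂)/‖w₁ × w₂‖` where `w₁, w₂` are the columns of `Ω`. -/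
def normalOf (Ω : Pt → Matrix (Fin 3) (Fin 2) ℝ) (p : Pt) : Fin 3 → ℝ :=
  (enorm3 (crossProduct (fun i => Ω p i 0) (fun i => Ω p i 1)))⁻¹ •
    crossProduct (fun i => Ω p i 0) (fun i => Ω p i 1)

/-- First fundamental form matrix of a map `y`. -/
def IOf (y : Pt → Fin 3 → ℝ) (p : Pt) : Matrix (Fin 2) (Fin 2) ℝ :=
  (jac y p)ᵀ * jac y p

/-- Second fundamental form matrix of a map `y` with respect to a unit normal `ν`. -/
def IIOf (y ν : Pt → Fin 3 → ℝ) (p : Pt) : Matrix (Fin 2) (Fin 2) ℝ :=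
  -((jac y p)ᵀ * jac ν p)

/-- Weingarten matrix `α := −IIᵀ I⁻¹` of a map `y` with unit normal `ν`. -/
def weinOf (y ν : Pt → Fin 3 → ℝ) (p : Pt) : Matrix (Fin 2) (Fin 2) ℝ :=
  -((IIOf y ν p)ᵀ * (IOf y p)⁻¹)

/-- Gaussian curvature of an immersion `y` with unit normal `ν`. -/
def KgOf (y ν : Pt → Fin 3 → ℝ) (p : Pt) : ℝ :=
  (IIOf y ν p).det / (IOf y p).det

/-- Mean curvature of an immersion `y` with unit normal `ν`. -/
def HmOf (y ν : Pt → Fin 3 → ℝ) (p : Pt) : ℝ :=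
  -(1 / 2) * (weinOf y ν p).trace

/-- Smaller principal curvature `H − √(H² − K)` of an immersion `y`. -/
def k1Of (y ν : Pt → Fin 3 → ℝ) (p : Pt) : ℝ :=
  HmOf y ν p - Real.sqrt ((HmOf y ν p) ^ 2 - KgOf y ν p)

/-- Larger principal curvature `H + √(H² − K)` of an immersion `y`. -/
def k2Of (y ν : Pt → Fin 3 → ℝ) (p : Pt) : ℝ :=
  HmOf y ν p + Real.sqrt ((HmOf y ν p) ^ 2 - KgOf y ν p)

/-- A frontal `x : U → ℝ³` equipped with a tangent moving base (tmb) `Ω` and the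
induced smooth matrix-valued maps `Λ`, `μ` satisfying `Dx = Ω Λᵀ` and `Dn = Ω μᵀ` on `U`. -/
structure Frontal where
  /-- the domain -/
  U : Set Pt
  isOpen_U : IsOpen U
  /-- the frontal -/
  x : Pt → Fin 3 → ℝ
  /-- the tangent moving base -/
  Ω : Pt → Matrix (Fin 3) (Fin 2) ℝ
  /-- `Λ` with `Dx = Ω Λᵀ` -/
  Λ : Pt → Matrix (Fin 2) (Fin 2) ℝ
  /-- `μ` with `Dn = Ω μᵀ` -/
  μ : Pt → Matrix (Fin 2) (Fin 2) ℝ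
  smooth_x : ContDiffOn ℝ (⊤ : ℕ∞) x U
  smooth_Ω : ∀ i j, ContDiffOn ℝ (⊤ : ℕ∞) (fun p => Ω p i j) U
  smooth_Λ : ∀ i j, ContDiffOn ℝ (⊤ : ℕ∞) (fun p => Λ p i j) U
  smooth_μ : ∀ i j, ContDiffOn ℝ (⊤ : ℕ∞) (fun p => μ p i j) U
  /-- the columns of `Ω` are linearly independent (nonzero cross product) -/
  indep : ∀ p ∈ U, crossProduct (fun i => Ω p i 0) (fun i => Ω p i 1) ≠ 0
  decomp_x : ∀ p ∈ U, jac x p = Ω p * (Λ p)ᵀ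
  decomp_n : ∀ p ∈ U, jac (normalOf Ω) p = Ω p * (μ p)ᵀ

namespace Frontal

variable (F : Frontal)

/-- The unit normal induced by the tmb. -/
def n : Pt → Fin 3 → ℝ := normalOf F.Ω

/-- `λ_Ω := det Λ`. -/
def lam (p : Pt) : ℝ := (F.Λ p).det

/-- The Ω-relative curvature `K_Ω := det μ`. -/
def KΩ (p : Pt) : ℝ := (F.μ p).det

/-- `α_Ω := μ · adj(Λ)`. -/
def αΩ (p : Pt) : Matrix (Fin 2) (Fin 2) ℝ := F.μ p * (F.Λ p).adjugate

/-- The Ω-relative mean curvature `H_Ω := −(1/2) tr α_Ω`. -/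
def HΩ (p : Pt) : ℝ := -(1 / 2) * (F.αΩ p).trace

/-- The relative principal curvature `k_{1Ω} := H_Ω − √(H_Ω² − λ_Ω K_Ω)`. -/
def k1Ω (p : Pt) : ℝ := F.HΩ p - Real.sqrt ((F.HΩ p) ^ 2 - F.lam p * F.KΩ p)

/-- The relative principal curvature `k_{2Ω} := H_Ω + √(H_Ω² − λ_Ω K_Ω)`. -/
def k2Ω (p : Pt) : ℝ := F.HΩ p + Real.sqrt ((F.HΩ p) ^ 2 - F.lam p * F.KΩ p)

/-- The singular set `Σ(x) = λ_Ω⁻¹(0)`. -/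
def sing : Set Pt := {p ∈ F.U | F.lam p = 0}

/-- The regular set `U − Σ(x)`. -/
def reg : Set Pt := {p ∈ F.U | F.lam p ≠ 0}

/-- A frontal is proper if its singular set has empty interior. -/
def IsProper : Prop := interior F.sing = ∅

/-- `x` is a wavefront if `(x, n) : U → ℝ³ × S²` is an immersion. -/
def IsWavefront : Prop :=
  ∀ p ∈ F.U, (Matrix.fromRows (jac F.x p) (jac F.n p)).rank = 2

/-- First fundamental form matrix `I = Dxᵀ Dx`. -/
def Imat (p : Pt) : Matrix (Fin 2) (Fin 2) ℝ := IOf F.x p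

/-- Second fundamental form matrix `II = −Dxᵀ Dn`. -/
def IImat (p : Pt) : Matrix (Fin 2) (Fin 2) ℝ := IIOf F.x F.n p

/-- Weingarten matrix `α := −IIᵀ I⁻¹` (meaningful off the singular set). -/
def Wein (p : Pt) : Matrix (Fin 2) (Fin 2) ℝ := weinOf F.x F.n p

/-- Coefficient `e` of the second fundamental form. -/
def e (p : Pt) : ℝ := F.IImat p 0 0

/-- Coefficient `f` of the second fundamental form. -/
def f (p : Pt) : ℝ := F.IImat p 0 1

/-- Coefficient `g` of the second fundamental form. -/
def g (p : Pt) : ℝ := F.IImat p 1 1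

/-- Gaussian curvature (meaningful off the singular set). -/
def Kg (p : Pt) : ℝ := KgOf F.x F.n p

/-- Mean curvature (meaningful off the singular set). -/
def Hm (p : Pt) : ℝ := HmOf F.x F.n p

/-- Principal curvature `κ₋ := H − √(H² − K)`. -/
def κm (p : Pt) : ℝ := F.Hm p - Real.sqrt ((F.Hm p) ^ 2 - F.Kg p)

/-- Principal curvature `κ₊ := H + √(H² − K)`. -/
def κp (p : Pt) : ℝ := F.Hm p + Real.sqrt ((F.Hm p) ^ 2 - F.Kg p)

/-- `k₁ := κ₋` where `λ_Ω > 0` and `k₁ := κ₊` where `λ_Ω < 0`. -/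
def k1 (p : Pt) : ℝ := if 0 < F.lam p then F.κm p else F.κp p

/-- `k₂ := κ₊` where `λ_Ω > 0` and `k₂ := κ₋` where `λ_Ω < 0`. -/
def k2 (p : Pt) : ℝ := if 0 < F.lam p then F.κp p else F.κm p

/-- `x` is parallelly smoothable at `p` : for some `ε > 0` and some open
neighborhood `V` of `p`, `rank D(x + l·n)(q) = 2` for all `(q,l) ∈ V × (0,ε)`
or for all `(q,l) ∈ V × (−ε,0)`. -/
def ParSmoothable (p : Pt) : Prop :=
  ∃ ε > (0 : ℝ), ∃ V : Set Pt, IsOpen V ∧ p ∈ V ∧ V ⊆ F.U ∧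
    ((∀ q ∈ V, ∀ l ∈ Set.Ioo (0 : ℝ) ε,
        (jac (fun z => F.x z + l • F.n z) q).rank = 2) ∨
     (∀ q ∈ V, ∀ l ∈ Set.Ioo (-ε) (0 : ℝ),
        (jac (fun z => F.x z + l • F.n z) q).rank = 2))

/-- `f` (defined off the singular set) has a `C^∞` extension to `V`. -/
def SmoothExtOn (f : Pt → ℝ) (V : Set Pt) : Prop :=
  ∃ g : Pt → ℝ, ContDiffOn ℝ (⊤ : ℕ∞) g V ∧ ∀ q ∈ V ∩ F.reg, g q = f q

/-- `f` has a `C^∞` extension to some open neighborhood of `p`. -/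
def SmoothExtNear (f : Pt → ℝ) (p : Pt) : Prop :=
  ∃ V : Set Pt, IsOpen V ∧ p ∈ V ∧ V ⊆ F.U ∧ F.SmoothExtOn f V

/-- Membership in the principal ideal `𝔗_Ω(V)` generated by `λ_Ω` in `C^∞(V,ℝ)`. -/
def memIdeal (f : Pt → ℝ) (V : Set Pt) : Prop :=
  ∃ φ : Pt → ℝ, ContDiffOn ℝ (⊤ : ℕ∞) φ V ∧ ∀ q ∈ V, f q = φ q * F.lam q

end Frontal

/-- `f` does not change sign on `V`. -/
def NoSignChange (f : Pt → ℝ) (V : Set Pt) : Prop :=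
  (∀ q ∈ V, 0 ≤ f q) ∨ (∀ q ∈ V, f q ≤ 0)

theorem Matrix.eq_zero_of_rank_eq_zero {m n : Type*} [Fintype m] [Fintype n] [DecidableEq n]
    {A : Matrix m n ℝ} (h : A.rank = 0) : A = 0 := by
  rw [Matrix.rank, Submodule.finrank_eq_zero, LinearMap.range_eq_bot] at h
  exact Matrix.ext_of_mulVec_single fun i => by
    rw [Matrix.zero_mulVec]
    exact LinearMap.congr_fun h (Pi.single i 1)

theorem Matrix.isUnit_iff_rank_eq_card {n : Type*} [Fintype n] [DecidableEq n]
    {A : Matrix n n ℝ} : IsUnit A ↔ A.rank = Fintype.card n := by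
  refine ⟨Matrix.rank_of_isUnit A, fun h => ?_⟩
  rw [← Matrix.linearIndependent_cols_iff_isUnit, linearIndependent_iff_card_eq_finrank_span,
    Set.finrank, ← Matrix.rank_eq_finrank_span_cols, h]

/-- The partial derivatives of the Jacobian of a `C²` map commute. -/
theorem fderiv_jac_comm {m : ℕ} {y : Pt → Fin m → ℝ} {p : Pt} (hy : ContDiffAt ℝ 2 y p)
    (k : Fin m) (i j : Fin 2) :
    fderiv ℝ (fun z => jac y z k i) p (Pi.single j 1) =
      fderiv ℝ (fun z => jac y z k j) p (Pi.single i 1) := by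
  have hd : DifferentiableAt ℝ (fderiv ℝ y) p :=
    (hy.fderiv_right (m := 1) (by norm_num)).differentiableAt (by norm_num)
  have key (a b : Fin 2) : fderiv ℝ (fun z => jac y z k a) p (Pi.single b 1) =
      fderiv ℝ (fderiv ℝ y) p (Pi.single b 1) (Pi.single a 1) k := by
    have h := hd.hasFDerivAt.clm_apply (hasFDerivAt_const (Pi.single a (1 : ℝ) : Pt) p)
    have h2 := ((hasFDerivAt_pi'.1 h) k).fderiv
    simp only [jac, Matrix.of_apply]
    rw [h2]
    simp
  rw [key, key, (hy.isSymmSndFDerivAt (by simp)).eq]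

theorem normalOf_dotProduct_col (Ω : Pt → Matrix (Fin 3) (Fin 2) ℝ) (p : Pt) (j : Fin 2) :
    ∑ k, Ω p k j * normalOf Ω p k = 0 := by
  have h0 := dot_self_cross (fun i => Ω p i 0) (fun i => Ω p i 1)
  have h1 := dot_cross_self (fun i => Ω p i 0) (fun i => Ω p i 1)
  have : (fun i => Ω p i j) ⬝ᵥ normalOf Ω p = 0 := by
    rw [normalOf, dotProduct_smul]
    fin_cases j
    · simp [h0]
    · simp [h1]
  exact this

/-- The second fundamental form is symmetric. -/
theorem jac_transpose_mul_jac_symm {y ν : Pt → Fin 3 → ℝ} {p : Pt}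
    (hy : ContDiffAt ℝ 2 y p) (hν : DifferentiableAt ℝ ν p)
    (horth : ∀ᶠ z in 𝓝 p, ∀ j, ∑ k, jac y z k j * ν z k = 0) :
    ((jac y p)ᵀ * jac ν p)ᵀ = (jac y p)ᵀ * jac ν p := by
  have hd : DifferentiableAt ℝ (fderiv ℝ y) p :=
    (hy.fderiv_right (m := 1) (by norm_num)).differentiableAt (by norm_num)
  have hjac (k : Fin 3) (j : Fin 2) : DifferentiableAt ℝ (fun z => jac y z k j) p := by
    have := hd.clm_apply (differentiableAt_const (Pi.single j (1 : ℝ) : Pt))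
    exact differentiableAt_pi.1 this k
  have hνk (k : Fin 3) : DifferentiableAt ℝ (fun z => ν z k) p := differentiableAt_pi.1 hν k
  have key (i j : Fin 2) : ((jac y p)ᵀ * jac ν p) j i =
      -∑ k, ν p k * fderiv ℝ (fun z => jac y z k j) p (Pi.single i 1) := by
    have h0 : (fun z => ∑ k, jac y z k j * ν z k) =ᶠ[𝓝 p] fun _ => (0 : ℝ) :=
      horth.mono fun z hz => hz j
    have h1 := h0.fderiv_eq (𝕜 := ℝ)
    have h2 : HasFDerivAt (fun z => ∑ k, jac y z k j * ν z k)
        (∑ k, (jac y p k j • fderiv ℝ (fun z => ν z k) p +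
          ν p k • fderiv ℝ (fun z => jac y z k j) p)) p :=
      HasFDerivAt.fun_sum fun k _ => (hjac k j).hasFDerivAt.mul (hνk k).hasFDerivAt
    have h3 := DFunLike.congr_fun (h2.fderiv.symm.trans h1) (Pi.single i 1)
    have h4 (k : Fin 3) : jac ν p k i = fderiv ℝ (fun z => ν z k) p (Pi.single i 1) := by
      simp [jac, fderiv_apply hν k]
    simp only [Matrix.mul_apply, Matrix.transpose_apply, h4]
    simp [Finset.sum_add_distrib] at h3
    linarith
  ext i j
  rw [Matrix.transpose_apply, key, key]
  simp only [fderiv_jac_comm hy _ j i]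

theorem contDiffAt_normalOf {Ω : Pt → Matrix (Fin 3) (Fin 2) ℝ} {p : Pt} {r : WithTop ℕ∞}
    (hΩ : ∀ i j, ContDiffAt ℝ r (fun q => Ω q i j) p)
    (h : crossProduct (fun i => Ω p i 0) (fun i => Ω p i 1) ≠ 0) :
    ContDiffAt ℝ r (normalOf Ω) p := by
  have hc : ContDiffAt ℝ r
      (fun q => crossProduct (fun i => Ω q i 0) (fun i => Ω q i 1)) p := by
    refine contDiffAt_pi.2 fun k => ?_
    fin_cases k <;> simp only [cross_apply] <;>
      exact ((hΩ _ _).mul (hΩ _ _)).sub ((hΩ _ _).mul (hΩ _ _))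
  have hck := contDiffAt_pi.1 hc
  have hn : (crossProduct (fun i => Ω p i 0) (fun i => Ω p i 1)) ⬝ᵥ
      (crossProduct (fun i => Ω p i 0) (fun i => Ω p i 1)) ≠ 0 := by
    simpa [dotProduct_self_eq_zero] using h
  have hdot : ContDiffAt ℝ r (fun q => crossProduct (fun i => Ω q i 0) (fun i => Ω q i 1) ⬝ᵥ
      crossProduct (fun i => Ω q i 0) (fun i => Ω q i 1)) p := by
    simp only [dotProduct]
    exact ContDiffAt.sum fun k _ => (hck k).mul (hck k)
  have hpos := lt_of_le_of_ne (Finset.sum_nonneg fun _ _ => mul_self_nonneg _) hn.symm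
  exact ((hdot.sqrt hn).inv (Real.sqrt_pos.2 hpos).ne').smul hc

theorem Frontal.contDiffAt_n (F : Frontal) {q : Pt} (hq : q ∈ F.U) :
    ContDiffAt ℝ (⊤ : ℕ∞) F.n q :=
  contDiffAt_normalOf
    (fun i j => (F.smooth_Ω i j).contDiffAt (F.isOpen_U.mem_nhds hq)) (F.indep q hq)

theorem jac_add_smul {f g : Pt → Fin 3 → ℝ} {q : Pt} (hf : DifferentiableAt ℝ f q)
    (hg : DifferentiableAt ℝ g q) (l : ℝ) :
    jac (fun z => f z + l • g z) q = jac f q + l • jac g q := by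
  have h : fderiv ℝ (fun z => f z + l • g z) q = fderiv ℝ f q + l • fderiv ℝ g q :=
    (hf.hasFDerivAt.add (hg.hasFDerivAt.const_smul l)).fderiv
  ext i j
  simp [jac, h]

theorem Matrix.mul_self_eq_zero_of_trace_det {A : Matrix (Fin 2) (Fin 2) ℝ}
    (ht : A.trace = 0) (hd : A.det = 0) : A * A = 0 := by
  rw [Matrix.trace_fin_two] at ht
  rw [Matrix.det_fin_two] at hd
  have h1 : A 1 1 = -A 0 0 := by linarith
  rw [h1] at hd
  ext i j
  fin_cases i <;> fin_cases j <;> simp [Matrix.mul_apply, Fin.sum_univ_two, h1] <;> linarith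

/-- If `A` is self-adjoint for the Gram matrix `Bᵀ * B` and squares to zero, then `B * Aᵀ = 0`. -/
theorem Matrix.mul_transpose_eq_zero_of_sq_eq_zero {m n : Type*} [Fintype m] [Fintype n]
    {A : Matrix n n ℝ} {B : Matrix m n ℝ} (hs : (Bᵀ * (B * Aᵀ))ᵀ = Bᵀ * (B * Aᵀ))
    (hA : A * A = 0) : B * Aᵀ = 0 := by
  rw [← Matrix.conjTranspose_mul_self_eq_zero, Matrix.conjTranspose_eq_transpose_of_trivial]
  calc (B * Aᵀ)ᵀ * (B * Aᵀ) = A * (Bᵀ * (B * Aᵀ)) := by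
        simp [Matrix.transpose_mul, Matrix.mul_assoc]
    _ = A * (Bᵀ * (B * Aᵀ))ᵀ := by rw [hs]
    _ = (A * A) * (Bᵀ * B) := by simp [Matrix.transpose_mul, Matrix.mul_assoc]
    _ = 0 := by rw [hA, Matrix.zero_mul]

theorem isUnit_IOf {y : Pt → Fin 3 → ℝ} {q : Pt} (h : (jac y q).rank = 2) :
    IsUnit (IOf y q) := by
  rw [Matrix.isUnit_iff_rank_eq_card, IOf, Matrix.rank_transpose_mul_self, h, Fintype.card_fin]

/-- Curvatures of an immersion `y` with symmetric second fundamental form in terms of the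
matrix `M` with `Dν = Dy Mᵀ`. -/
theorem curvatures_of_jac_eq {y ν : Pt → Fin 3 → ℝ} {q : Pt} {M : Matrix (Fin 2) (Fin 2) ℝ}
    (h : (jac y q).rank = 2) (hM : jac ν q = jac y q * Mᵀ) :
    HmOf y ν q = -(1 / 2) * M.trace ∧ KgOf y ν q = M.det := by
  have hI := isUnit_IOf h
  have hdet : IsUnit (IOf y q).det := (Matrix.isUnit_iff_isUnit_det _).1 hI
  have hII : IIOf y ν q = -(IOf y q * Mᵀ) := by rw [IIOf, IOf, hM, Matrix.mul_assoc]
  have hsymm : (IOf y q)ᵀ = IOf y q := by simp [IOf, Matrix.transpose_mul]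
  constructor
  · rw [HmOf, weinOf, hII, Matrix.transpose_neg, Matrix.transpose_mul, hsymm,
      Matrix.transpose_transpose, Matrix.neg_mul, neg_neg, Matrix.mul_nonsing_inv_cancel_right _ _ hdet]
  · rw [KgOf, hII, Matrix.det_neg, Matrix.det_mul, Matrix.det_transpose, Fintype.card_fin]
    field_simp [hdet.ne_zero]

/-- With `Ω = Dy_l` as above, `rank Dx(p) = 0` iff `y_l` has an
umbilical point at `p` with positive Gaussian curvature (equivalently
`K_l(p) = 1/l²` and `H_l(p) = −1/l`), and `rank Dx(p) = 1` iff `y_l` is free of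
umbilical points on some neighborhood of `p`. -/
theorem stmt5 (F : Frontal) (hW : F.IsWavefront) (p : Pt) (hp : p ∈ F.sing)
    (l : ℝ) (hl : 0 < l) (V : Set Pt) (hV : IsOpen V) (hpV : p ∈ V) (hVU : V ⊆ F.U)
    (y : Pt → Fin 3 → ℝ) (hy : y = fun z => F.x z + l • F.n z)
    (hemb : Topology.IsEmbedding (fun q : V => y q))
    (himm : ∀ q ∈ V, (jac y q).rank = 2)
    (hΩ : ∀ q ∈ V, F.Ω q = jac y q) :
    ((jac F.x p).rank = 0 ↔ ((HmOf y F.n p) ^ 2 = KgOf y F.n p ∧ 0 < KgOf y F.n p)) ∧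
    ((jac F.x p).rank = 0 ↔ (KgOf y F.n p = 1 / l ^ 2 ∧ HmOf y F.n p = -(1 / l))) ∧
    ((jac F.x p).rank = 1 ↔ ∃ W : Set Pt, IsOpen W ∧ p ∈ W ∧ W ⊆ V ∧
      ∀ q ∈ W, (HmOf y F.n q) ^ 2 ≠ KgOf y F.n q) := by
  obtain ⟨hpU, hlam⟩ := hp
  have hxd (q) (hq : q ∈ V) : ContDiffAt ℝ (⊤ : ℕ∞) F.x q :=
    F.smooth_x.contDiffAt (F.isOpen_U.mem_nhds (hVU hq))
  have hnd (q) (hq : q ∈ V) : ContDiffAt ℝ (⊤ : ℕ∞) F.n q := F.contDiffAt_n (hVU hq)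
  have hx (q) (hq : q ∈ V) : jac F.x q = jac y q * (F.Λ q)ᵀ := by
    rw [F.decomp_x q (hVU hq), hΩ q hq]
  have hn (q) (hq : q ∈ V) : jac F.n q = jac y q * (F.μ q)ᵀ := by
    rw [← hΩ q hq, ← F.decomp_n q (hVU hq), Frontal.n]
  have hHK (q) (hq : q ∈ V) := curvatures_of_jac_eq (himm q hq) (hn q hq)
  have hΛμ : F.Λ p = 1 - l • F.μ p := by
    have h1 : jac y p = jac F.x p + l • jac F.n p := by
      rw [hy]
      exact jac_add_smul ((hxd p hpV).differentiableAt (by simp))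
        ((hnd p hpV).differentiableAt (by simp)) l
    have h2 : IOf y p * (F.Λ p)ᵀ = IOf y p * (1 - l • F.μ p)ᵀ := by
      rw [IOf, Matrix.mul_assoc, Matrix.mul_assoc, ← hx p hpV, Matrix.transpose_sub,
        Matrix.transpose_one, Matrix.transpose_smul, Matrix.mul_sub, Matrix.mul_one,
        Matrix.mul_smul, ← hn p hpV, eq_sub_of_add_eq h1.symm]
    exact Matrix.transpose_injective ((isUnit_IOf (himm p hpV)).mul_left_cancel h2)
  have hyd : ContDiffAt ℝ 2 y p := by
    rw [hy]
    exact ((hxd p hpV).add ((hnd p hpV).const_smul l)).of_le (WithTop.coe_le_coe.2 le_top)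
  have hsymm : ((jac y p)ᵀ * (jac y p * (F.Λ p)ᵀ))ᵀ = (jac y p)ᵀ * (jac y p * (F.Λ p)ᵀ) := by
    have h := jac_transpose_mul_jac_symm hyd ((hnd p hpV).differentiableAt (by simp))
      (Filter.eventually_of_mem (hV.mem_nhds hpV) fun z hz j => by
        rw [← hΩ z hz]; exact normalOf_dotProduct_col F.Ω z j)
    rw [hn p hpV] at h
    rw [hΛμ, Matrix.transpose_sub, Matrix.transpose_one, Matrix.transpose_smul, Matrix.mul_sub,
      Matrix.mul_one, Matrix.mul_sub, Matrix.transpose_sub, Matrix.mul_smul, Matrix.mul_smul,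
      Matrix.transpose_smul, h, Matrix.transpose_mul, Matrix.transpose_transpose]
  have hrank0 : (jac F.x p).rank = 0 ↔ (F.Λ p).trace = 0 := by
    constructor
    · intro h
      have h0 := Matrix.eq_zero_of_rank_eq_zero h
      rw [hx p hpV] at h0
      have h1 : IOf y p * (F.Λ p)ᵀ = IOf y p * 0 := by
        rw [IOf, Matrix.mul_assoc, h0, Matrix.mul_zero, Matrix.mul_zero]
      have h2 := (isUnit_IOf (himm p hpV)).mul_left_cancel h1
      rw [← Matrix.trace_transpose, h2, Matrix.trace_zero]
    · intro h
      rw [hx p hpV, Matrix.mul_transpose_eq_zero_of_sq_eq_zero hsymm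
        (Matrix.mul_self_eq_zero_of_trace_det h hlam), Matrix.rank_zero]
  have hrank : (jac F.x p).rank < 2 := by
    have hle : (jac F.x p).rank ≤ (F.Λ p)ᵀ.rank := by
      rw [hx p hpV]; exact Matrix.rank_mul_le_right _ _
    refine lt_of_le_of_lt hle (lt_of_le_of_ne (Matrix.rank_le_width _) fun h => ?_)
    have h1 : IsUnit (F.Λ p)ᵀ := Matrix.isUnit_iff_rank_eq_card.2 (by rw [h, Fintype.card_fin])
    rw [Matrix.isUnit_iff_isUnit_det, Matrix.det_transpose] at h1
    exact h1.ne_zero hlam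
  obtain ⟨hH, hK⟩ := hHK p hpV
  have hH' : HmOf y F.n p = -(2 - (F.Λ p).trace) / (2 * l) := by
    rw [hH, hΛμ]
    simp only [Matrix.trace_sub, Matrix.trace_one, Matrix.trace_smul, Fintype.card_fin, smul_eq_mul]
    field_simp
    push_cast
    ring
  have hK' : KgOf y F.n p = (1 - (F.Λ p).trace) / l ^ 2 := by
    have hlam' : (F.Λ p).det = 0 := hlam
    rw [hΛμ, Matrix.det_fin_two] at hlam'
    rw [hK, hΛμ, Matrix.det_fin_two, Matrix.trace_fin_two, eq_div_iff (by positivity)]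
    simp at hlam' ⊢
    linarith
  have humb : (HmOf y F.n p) ^ 2 = KgOf y F.n p ↔ (F.Λ p).trace = 0 := by
    rw [hH', hK', div_pow, div_eq_div_iff (by positivity) (by positivity)]
    refine ⟨fun h => ?_, fun h => by rw [h]; ring⟩
    have h1 : l ^ 2 * (F.Λ p).trace ^ 2 = 0 := by linarith
    simpa [hl.ne'] using h1
  refine ⟨?_, ?_, ?_⟩
  · rw [hrank0, humb]
    refine ⟨fun h => ⟨h, ?_⟩, fun h => h.1⟩
    rw [hK', h]
    simp only [sub_zero]
    positivity
  · rw [hrank0, hK', hH']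
    refine ⟨fun h => ?_, fun h => ?_⟩
    · rw [h]
      constructor
      · simp
      · field_simp
        norm_num
    · have h1 := h.1
      rw [div_left_inj' (by positivity)] at h1
      linarith
  · have hrank1 : (jac F.x p).rank = 1 ↔ ¬ (HmOf y F.n p) ^ 2 = KgOf y F.n p := by
      rw [humb, ← hrank0]
      omega
    rw [hrank1]
    refine ⟨fun h => ?_, fun ⟨W, _, hpW, _, hW'⟩ => hW' p hpW⟩
    have hμc (i j) : ContinuousAt (fun q => F.μ q i j) p :=
      ((F.smooth_μ i j).contDiffAt (F.isOpen_U.mem_nhds hpU)).continuousAt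
    have hc : ContinuousAt (fun q => (-(1 / 2) * (F.μ q).trace) ^ 2 - (F.μ q).det) p := by
      simp only [Matrix.trace_fin_two, Matrix.det_fin_two]
      exact ((continuousAt_const.mul ((hμc _ _).add (hμc _ _))).pow 2).sub
        (((hμc _ _).mul (hμc _ _)).sub ((hμc _ _).mul (hμc _ _)))
    have hev := (hc.eventually_ne (by rwa [← hH, ← hK, sub_ne_zero])).and
      (hV.mem_nhds hpV)
    obtain ⟨W, hWsub, hWo, hpW⟩ := mem_nhds_iff.1 hev
    refine ⟨W, hWo, hpW, fun q hq => (hWsub hq).2, fun q hq => ?_⟩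
    obtain ⟨h1, h2⟩ := hWsub hq
    rw [(hHK q h2).1, (hHK q h2).2]
    exact sub_ne_zero.1 h1
end
end

section
/- Let x : U → ℝ³ be a proper wavefront, Ω a tmb of x, and p ∈ Σ(x) with rank(Dx(p)) = 1. Then there is an open neighborhood V ⊆ U of p on which exactly one of the functions k₁, k₂ (defined on V − Σ(x)) admits a C^∞ extension to V; more precisely, k₁ (resp. k₂) admits a C^∞ extension to some neighborhood of p if and only if k_{1Ω}(p) = 0 (resp. k_{2Ω}(p) = 0). Moreover, |k₁(u,v)| → ∞ as (u,v) → p through Σ(x)ᶜ if and only if k_{1Ω}(p) ≠ 0, and |k₂(u,v)| → ∞ as (u,v) → p through Σ(x)ᶜ if and only if k_{2Ω}(p) ≠ 0. -/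
/- Common framework for frontals and tangent moving bases, following
   "Curvatures on fronts" conventions. -/

noncomputable section

open Matrix Topology Filter

namespace Frontal

variable (F : Frontal)

lemma contDiffOn_lam : ContDiffOn ℝ (⊤ : ℕ∞) F.lam F.U := by
  have h : F.lam = fun q => F.Λ q 0 0 * F.Λ q 1 1 - F.Λ q 0 1 * F.Λ q 1 0 :=
    funext fun q => Matrix.det_fin_two _
  rw [h]
  exact ((F.smooth_Λ 0 0).mul (F.smooth_Λ 1 1)).sub ((F.smooth_Λ 0 1).mul (F.smooth_Λ 1 0))

lemma contDiffOn_KΩ : ContDiffOn ℝ (⊤ : ℕ∞) F.KΩ F.U := by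
  have h : F.KΩ = fun q => F.μ q 0 0 * F.μ q 1 1 - F.μ q 0 1 * F.μ q 1 0 :=
    funext fun q => Matrix.det_fin_two _
  rw [h]
  exact ((F.smooth_μ 0 0).mul (F.smooth_μ 1 1)).sub ((F.smooth_μ 0 1).mul (F.smooth_μ 1 0))

lemma trace_αΩ (q : Pt) : (F.αΩ q).trace =
    F.μ q 0 0 * F.Λ q 1 1 - F.μ q 0 1 * F.Λ q 1 0 - F.μ q 1 0 * F.Λ q 0 1
      + F.μ q 1 1 * F.Λ q 0 0 := by
  simp [αΩ, Matrix.trace_fin_two, Matrix.adjugate_fin_two, Matrix.mul_apply, Fin.sum_univ_two]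
  ring

lemma contDiffOn_HΩ : ContDiffOn ℝ (⊤ : ℕ∞) F.HΩ F.U := by
  have h : F.HΩ = fun q => -(1 / 2) * (F.μ q 0 0 * F.Λ q 1 1 - F.μ q 0 1 * F.Λ q 1 0
      - F.μ q 1 0 * F.Λ q 0 1 + F.μ q 1 1 * F.Λ q 0 0) :=
    funext fun q => by rw [HΩ, trace_αΩ]
  rw [h]
  exact contDiffOn_const.mul (((((F.smooth_μ 0 0).mul (F.smooth_Λ 1 1)).sub
    ((F.smooth_μ 0 1).mul (F.smooth_Λ 1 0))).sub
    ((F.smooth_μ 1 0).mul (F.smooth_Λ 0 1))).add ((F.smooth_μ 1 1).mul (F.smooth_Λ 0 0)))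

lemma cross_dot_self_eq_det_gram (A : Matrix (Fin 3) (Fin 2) ℝ) :
    crossProduct (fun i => A i 0) (fun i => A i 1) ⬝ᵥ
      crossProduct (fun i => A i 0) (fun i => A i 1) = (Aᵀ * A).det := by
  simp [cross_apply, Matrix.det_fin_two, Matrix.mul_apply, dotProduct, Fin.sum_univ_three]
  ring

lemma det_gram_pos {q : Pt} (hq : q ∈ F.U) : 0 < ((F.Ω q)ᵀ * F.Ω q).det := by
  rw [← cross_dot_self_eq_det_gram]
  refine lt_of_le_of_ne (Finset.sum_nonneg fun i _ => mul_self_nonneg _) (Ne.symm ?_)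
  rw [Ne, dotProduct_self_eq_zero]
  exact F.indep q hq

lemma enorm3_pos {q : Pt} (hq : q ∈ F.U) :
    0 < enorm3 (crossProduct (fun i => F.Ω q i 0) (fun i => F.Ω q i 1)) := by
  rw [enorm3, Real.sqrt_pos, cross_dot_self_eq_det_gram]
  exact F.det_gram_pos hq

lemma contDiffOn_n : ContDiffOn ℝ (⊤ : ℕ∞) F.n F.U := by
  have hc : ContDiffOn ℝ (⊤ : ℕ∞)
      (fun q => crossProduct (fun i => F.Ω q i 0) (fun i => F.Ω q i 1)) F.U := by
    rw [contDiffOn_pi]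
    have h := F.smooth_Ω
    intro i
    fin_cases i <;> simp [cross_apply]
    · exact ((h 1 0).mul (h 2 1)).sub ((h 2 0).mul (h 1 1))
    · exact ((h 2 0).mul (h 0 1)).sub ((h 0 0).mul (h 2 1))
    · exact ((h 0 0).mul (h 1 1)).sub ((h 1 0).mul (h 0 1))
  have hd : ContDiffOn ℝ (⊤ : ℕ∞)
      (fun q => crossProduct (fun i => F.Ω q i 0) (fun i => F.Ω q i 1) ⬝ᵥ
        crossProduct (fun i => F.Ω q i 0) (fun i => F.Ω q i 1)) F.U := by
    unfold dotProduct
    exact ContDiffOn.sum fun i _ => (contDiffOn_pi.1 hc i).mul (contDiffOn_pi.1 hc i)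
  refine ContDiffOn.smul (ContDiffOn.inv (hd.sqrt fun q hq => ?_) fun q hq => ?_) hc
  · rw [cross_dot_self_eq_det_gram]
    exact (F.det_gram_pos hq).ne'
  · exact (F.enorm3_pos hq).ne'

lemma jac_x_dot_n {q : Pt} (hq : q ∈ F.U) (j : Fin 2) :
    ∑ i, fderiv ℝ F.x q (Pi.single j 1) i * F.n q i = 0 := by
  have h : ∀ i, fderiv ℝ F.x q (Pi.single j 1) i = (F.Ω q * (F.Λ q)ᵀ) i j := fun i => by
    rw [← F.decomp_x q hq]; rfl
  simp only [h]
  simp [n, normalOf, Fin.sum_univ_three, cross_apply, Matrix.mul_apply, Fin.sum_univ_two]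
  ring

lemma snd_fderiv_dot_n {q : Pt} (hq : q ∈ F.U) (i j : Fin 2) :
    ∑ a, (fderiv ℝ (fderiv ℝ F.x) q (Pi.single i 1) (Pi.single j 1) a * F.n q a +
      jac F.x q a j * jac F.n q a i) = 0 := by
  have hU := F.isOpen_U.mem_nhds hq
  have hx : DifferentiableAt ℝ (fderiv ℝ F.x) q :=
    ((F.smooth_x.contDiffAt hU).fderiv_right (m := 1) (by norm_cast)).differentiableAt (by norm_num)
  have hn : DifferentiableAt ℝ F.n q := (F.contDiffOn_n.contDiffAt hU).differentiableAt (by simp)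
  have hx' : ∀ a, HasFDerivAt (fun z => fderiv ℝ F.x z (Pi.single j 1) a)
      ((ContinuousLinearMap.proj a).comp
        ((fderiv ℝ (fderiv ℝ F.x) q).flip (Pi.single j 1))) q := fun a => by
    have h1 := hx.hasFDerivAt.clm_apply (hasFDerivAt_const (Pi.single j 1 : Pt) q)
    rw [ContinuousLinearMap.comp_zero, zero_add] at h1
    exact (hasFDerivAt_pi'.1 h1) a
  have hn' : ∀ a, HasFDerivAt (fun z => F.n z a)
      ((ContinuousLinearMap.proj a).comp (fderiv ℝ F.n q)) q :=
    fun a => (hasFDerivAt_pi'.1 hn.hasFDerivAt) a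
  have hs := HasFDerivAt.fun_sum (u := Finset.univ) fun a _ => (hx' a).mul (hn' a)
  have h0 : (fun z => ∑ a, fderiv ℝ F.x z (Pi.single j 1) a * F.n z a) =ᶠ[𝓝 q] fun _ => 0 := by
    filter_upwards [hU] with z hz using F.jac_x_dot_n hz j
  have := hs.unique ((hasFDerivAt_const (0 : ℝ) q).congr_of_eventuallyEq h0)
  have := congrArg (fun L => L (Pi.single i 1)) this
  simp only [_root_.sum_apply] at this
  rw [← show _ = (0 : ℝ) from this]
  refine Finset.sum_congr rfl fun a _ => ?_
  simp [jac]
  ring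

/-- The matrix `Dxᵀ Dn` is symmetric. -/
lemma jac_x_transpose_mul_jac_n_symm {q : Pt} (hq : q ∈ F.U) :
    (jac F.x q)ᵀ * jac F.n q = (jac F.n q)ᵀ * jac F.x q := by
  have hU := F.isOpen_U.mem_nhds hq
  have hsymm : IsSymmSndFDerivAt ℝ F.x q :=
    (F.smooth_x.contDiffAt hU).isSymmSndFDerivAt (by simp; norm_cast)
  ext j i
  have h1 := F.snd_fderiv_dot_n hq i j
  have h2 := F.snd_fderiv_dot_n hq j i
  rw [hsymm.eq] at h1
  rw [Finset.sum_add_distrib] at h1 h2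
  simp only [Matrix.mul_apply, Matrix.transpose_apply]
  have : ∀ a, jac F.n q a j * jac F.x q a i = jac F.x q a i * jac F.n q a j :=
    fun a => mul_comm _ _
  simp only [this]
  linarith

/-- At a singular point of rank one of a wavefront the relative mean curvature does not vanish. -/
lemma HΩ_ne_zero (hW : F.IsWavefront) {p : Pt} (hp : p ∈ F.sing) (hr : (jac F.x p).rank = 1) :
    F.HΩ p ≠ 0 := by
  intro hH
  obtain ⟨hU, hl⟩ := hp
  have htr : (F.αΩ p).trace = 0 := by
    unfold HΩ at hH; linarith
  rw [trace_αΩ] at htr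
  obtain ⟨k, hk, hkΛ⟩ := Matrix.exists_vecMul_eq_zero_iff.2 hl
  have hkL : (F.Λ p)ᵀ *ᵥ k = 0 := by rw [Matrix.mulVec_transpose, hkΛ]
  have hx := F.decomp_x p hU
  have hn : jac F.n p = F.Ω p * (F.μ p)ᵀ := F.decomp_n p hU
  have hxk : jac F.x p *ᵥ k = 0 := by
    rw [hx, ← Matrix.mulVec_mulVec, hkL, Matrix.mulVec_zero]
  set c := (F.μ p)ᵀ *ᵥ k with hc
  have hnk : jac F.n p *ᵥ k = F.Ω p *ᵥ c := by
    rw [hn, ← Matrix.mulVec_mulVec]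
  have hc0 : c ≠ 0 := by
    intro h0
    have hker : Matrix.fromRows (jac F.x p) (jac F.n p) *ᵥ k = 0 := by
      rw [Matrix.fromRows_mulVec, hxk, hnk, h0, Matrix.mulVec_zero]
      ext i; cases i <;> rfl
    have hrank := hW p hU
    have hli : LinearIndependent ℝ (Matrix.fromRows (jac F.x p) (jac F.n p)).col := by
      rw [linearIndependent_iff_card_eq_finrank_span, Set.finrank,
        ← Matrix.rank_eq_finrank_span_cols, hrank]
      simp
    exact hk (Matrix.mulVec_injective_iff.2 hli (by rw [hker, Matrix.mulVec_zero]))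
  have hΛ0 : F.Λ p ≠ 0 := by
    intro h0
    rw [hx, h0] at hr
    simp at hr
  have hsym := F.jac_x_transpose_mul_jac_n_symm hU
  have horth : (jac F.x p)ᵀ *ᵥ (F.Ω p *ᵥ c) = 0 := by
    rw [← hnk, Matrix.mulVec_mulVec, hsym, ← Matrix.mulVec_mulVec, hxk, Matrix.mulVec_zero]
  rw [hx, Matrix.transpose_mul, Matrix.transpose_transpose, ← Matrix.mulVec_mulVec] at horth
  set d := (F.Ω p)ᵀ *ᵥ (F.Ω p *ᵥ c) with hd
  have hcd : c ⬝ᵥ d ≠ 0 := by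
    rw [hd, Matrix.dotProduct_mulVec, Matrix.vecMul_transpose, Ne, dotProduct_self_eq_zero]
    intro h0
    have hd0 : ((F.Ω p)ᵀ * F.Ω p) *ᵥ c = 0 := by
      rw [← Matrix.mulVec_mulVec, h0, Matrix.mulVec_zero]
    exact hc0 (Matrix.eq_zero_of_mulVec_eq_zero (F.det_gram_pos hU).ne' hd0)
  have e0 : c 0 = F.μ p 0 0 * k 0 + F.μ p 1 0 * k 1 := by
    simp [hc]
  have e1 : c 1 = F.μ p 0 1 * k 0 + F.μ p 1 1 * k 1 := by
    simp [hc]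
  have l0 : F.Λ p 0 0 * k 0 + F.Λ p 1 0 * k 1 = 0 := by
    simpa [Matrix.mulVec, dotProduct, Fin.sum_univ_two] using congrFun hkL 0
  have l1 : F.Λ p 0 1 * k 0 + F.Λ p 1 1 * k 1 = 0 := by
    simpa [Matrix.mulVec, dotProduct, Fin.sum_univ_two] using congrFun hkL 1
  have hpar : ∀ j, c 0 * F.Λ p j 1 = c 1 * F.Λ p j 0 := by
    rw [Fin.forall_fin_two, e0, e1]
    constructor
    · linear_combination (-k 1) * htr + F.μ p 0 0 * l1 - F.μ p 0 1 * l0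
    · linear_combination k 0 * htr + F.μ p 1 0 * l1 - F.μ p 1 1 * l0
  have hort : ∀ j, F.Λ p j 0 * d 0 + F.Λ p j 1 * d 1 = 0 := fun j => by
    simpa [Matrix.mulVec, dotProduct, Fin.sum_univ_two] using congrFun horth j
  rw [dotProduct, Fin.sum_univ_two] at hcd
  refine hΛ0 (Matrix.ext fun j => Fin.forall_fin_two.2 ⟨?_, ?_⟩)
  · refine (mul_eq_zero.1 ?_).resolve_left hcd
    linear_combination c 0 * hort j - d 1 * hpar j
  · refine (mul_eq_zero.1 ?_).resolve_left hcd
    linear_combination c 1 * hort j + d 0 * hpar j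

lemma Hm_eq {q : Pt} (hq : q ∈ F.reg) : F.Hm q = F.HΩ q / F.lam q := by
  obtain ⟨hU, hl⟩ := hq
  have hG := (F.det_gram_pos hU).ne'
  have hn : jac F.n q = F.Ω q * (F.μ q)ᵀ := F.decomp_n q hU
  have hW : weinOf F.x F.n q = F.μ q * (F.Λ q)⁻¹ := by
    unfold weinOf IIOf IOf
    rw [F.decomp_x q hU, hn]
    set G := (F.Ω q)ᵀ * F.Ω q with hGd
    have hI : (F.Ω q * (F.Λ q)ᵀ)ᵀ * (F.Ω q * (F.Λ q)ᵀ) = F.Λ q * G * (F.Λ q)ᵀ := by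
      simp [hGd, Matrix.transpose_mul, Matrix.mul_assoc]
    have hII : (-((F.Ω q * (F.Λ q)ᵀ)ᵀ * (F.Ω q * (F.μ q)ᵀ)))ᵀ = -(F.μ q * G * (F.Λ q)ᵀ) := by
      simp [hGd, Matrix.transpose_mul, Matrix.mul_assoc]
    have hlT : IsUnit ((F.Λ q)ᵀ).det := by rw [Matrix.det_transpose]; exact isUnit_iff_ne_zero.2 hl
    rw [hI, hII, Matrix.mul_inv_rev, Matrix.mul_inv_rev, Matrix.neg_mul, neg_neg,
      Matrix.mul_assoc (F.μ q * G), ← Matrix.mul_assoc (F.Λ q)ᵀ, Matrix.mul_nonsing_inv _ hlT,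
      Matrix.one_mul, Matrix.mul_assoc, ← Matrix.mul_assoc G,
      Matrix.mul_nonsing_inv _ (isUnit_iff_ne_zero.2 hG), Matrix.one_mul]
  unfold Hm HmOf HΩ αΩ lam
  rw [hW, Matrix.inv_def, Matrix.mul_smul, Matrix.trace_smul, Ring.inverse_eq_inv', smul_eq_mul]
  ring

lemma Kg_eq {q : Pt} (hq : q ∈ F.reg) : F.Kg q = F.KΩ q / F.lam q := by
  obtain ⟨hU, hl⟩ := hq
  have hG := (F.det_gram_pos hU).ne'
  have hn : jac F.n q = F.Ω q * (F.μ q)ᵀ := F.decomp_n q hU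
  unfold Kg KgOf IIOf IOf KΩ
  rw [F.decomp_x q hU, hn]
  have hI : (F.Ω q * (F.Λ q)ᵀ)ᵀ * (F.Ω q * (F.Λ q)ᵀ)
      = F.Λ q * ((F.Ω q)ᵀ * F.Ω q) * (F.Λ q)ᵀ := by
    simp [Matrix.transpose_mul, Matrix.mul_assoc]
  have hII : (F.Ω q * (F.Λ q)ᵀ)ᵀ * (F.Ω q * (F.μ q)ᵀ)
      = F.Λ q * ((F.Ω q)ᵀ * F.Ω q) * (F.μ q)ᵀ := by
    simp [Matrix.transpose_mul, Matrix.mul_assoc]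
  rw [hI, hII, Matrix.det_neg, Matrix.det_mul, Matrix.det_mul (F.Λ q), Matrix.det_mul _ (F.Λ q)ᵀ,
    Matrix.det_mul (F.Λ q), Matrix.det_transpose, Matrix.det_transpose]
  simp only [Fintype.card_fin]
  change _ = _ / (F.Λ q).det
  have hl' : (F.Λ q).det ≠ 0 := hl
  field_simp

lemma sqrt_discr_eq {q : Pt} (hq : q ∈ F.reg) :
    Real.sqrt (F.Hm q ^ 2 - F.Kg q) = Real.sqrt (F.HΩ q ^ 2 - F.lam q * F.KΩ q) / |F.lam q| := by
  have hl : F.lam q ≠ 0 := hq.2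
  rw [F.Hm_eq hq, F.Kg_eq hq, ← Real.sqrt_sq_eq_abs, ← Real.sqrt_div' _ (sq_nonneg _)]
  congr 1
  field_simp

lemma k1_eq {q : Pt} (hq : q ∈ F.reg) : F.k1 q = F.k1Ω q / F.lam q := by
  have hl : F.lam q ≠ 0 := hq.2
  unfold k1 κm κp k1Ω
  rw [F.sqrt_discr_eq hq, F.Hm_eq hq]
  split_ifs with h
  · rw [abs_of_pos h]; ring
  · rw [abs_of_neg (lt_of_le_of_ne (not_lt.1 h) hl), div_neg]; ring

lemma k2_eq {q : Pt} (hq : q ∈ F.reg) : F.k2 q = F.k2Ω q / F.lam q := by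
  have hl : F.lam q ≠ 0 := hq.2
  unfold k2 κm κp k2Ω
  rw [F.sqrt_discr_eq hq, F.Hm_eq hq]
  split_ifs with h
  · rw [abs_of_pos h]; ring
  · rw [abs_of_neg (lt_of_le_of_ne (not_lt.1 h) hl), div_neg]; ring

lemma nhdsWithin_reg_neBot (hP : F.IsProper) {p : Pt} (hp : p ∈ F.U) :
    (𝓝[F.reg] p).NeBot := by
  rw [← mem_closure_iff_nhdsWithin_neBot, mem_closure_iff_nhds]
  intro t ht
  by_contra hne
  have hsub : t ∩ F.U ⊆ F.sing := fun q hq => by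
    refine ⟨hq.2, by_contra fun h => hne ⟨q, hq.1, hq.2, h⟩⟩
  have : p ∈ interior F.sing :=
    mem_interior_iff_mem_nhds.2
      (Filter.mem_of_superset (Filter.inter_mem ht (F.isOpen_U.mem_nhds hp)) hsub)
  rw [hP] at this
  exact this

lemma tendsto_abs_atTop {h a : Pt → ℝ} {p : Pt} (hp : p ∈ F.sing)
    (ha : ContinuousAt a p) (ha0 : a p ≠ 0) (hh : ∀ q ∈ F.reg, h q = a q / F.lam q) :
    Tendsto (fun q => |h q|) (𝓝[F.reg] p) atTop := by
  have hl : ContinuousAt F.lam p :=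
    F.contDiffOn_lam.continuousOn.continuousAt (F.isOpen_U.mem_nhds hp.1)
  have hl0 : Tendsto (fun q => |F.lam q|) (𝓝[F.reg] p) (𝓝[>] 0) := by
    refine tendsto_nhdsWithin_iff.2 ⟨?_, ?_⟩
    · have := hl.abs.tendsto.mono_left (nhdsWithin_le_nhds (s := F.reg))
      rwa [hp.2, abs_zero] at this
    · filter_upwards [self_mem_nhdsWithin] with q hq using abs_pos.2 hq.2
  have hmul := (ha.abs.tendsto.mono_left (nhdsWithin_le_nhds (s := F.reg))).pos_mul_atTop
    (abs_pos.2 ha0) (tendsto_inv_nhdsGT_zero.comp hl0)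
  refine hmul.congr' ?_
  filter_upwards [self_mem_nhdsWithin] with q hq
  rw [hh q hq, abs_div, div_eq_mul_inv]
  rfl

lemma SmoothExtNear.not_tendsto {h : Pt → ℝ} {p : Pt} (hne : (𝓝[F.reg] p).NeBot)
    (hs : F.SmoothExtNear h p) : ¬ Tendsto (fun q => |h q|) (𝓝[F.reg] p) atTop := by
  obtain ⟨V, hV, hpV, -, g, hg, hgh⟩ := hs
  have hgc := (hg.continuousOn.continuousAt (hV.mem_nhds hpV)).abs.tendsto.mono_left
    (nhdsWithin_le_nhds (s := F.reg))
  refine not_tendsto_atTop_of_tendsto_nhds (hgc.congr' ?_)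
  filter_upwards [self_mem_nhdsWithin, nhdsWithin_le_nhds (hV.mem_nhds hpV)] with q hq hqV
  rw [hgh q ⟨hqV, hq⟩]

lemma smoothExtNear_of_mul_eq {h a b : Pt → ℝ} {p : Pt} {V : Set Pt} (hV : IsOpen V)
    (hVU : V ⊆ F.U) (hp : p ∈ V) (hb : ContDiffOn ℝ (⊤ : ℕ∞) b V) (hb0 : b p ≠ 0)
    (hab : ∀ q ∈ V, a q * b q = F.lam q * F.KΩ q) (hh : ∀ q ∈ F.reg, h q = a q / F.lam q) :
    F.SmoothExtNear h p := by
  refine ⟨V ∩ b ⁻¹' {0}ᶜ, hb.continuousOn.isOpen_inter_preimage hV isOpen_compl_singleton,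
    ⟨hp, hb0⟩, fun q hq => hVU hq.1, fun q => F.KΩ q / b q, ?_, ?_⟩
  · exact (F.contDiffOn_KΩ.mono fun q hq => hVU hq.1).div
      (hb.mono Set.inter_subset_left) fun q hq => hq.2
  · rintro q ⟨⟨hqV, hqb⟩, hq⟩
    have hl : F.lam q ≠ 0 := hq.2
    have hqb' : b q ≠ 0 := hqb
    rw [hh q hq, div_eq_div_iff hqb' hl, hab q hqV]
    ring

/-- The dichotomy for a quotient `a / λ_Ω`, where `a` and `b` are the roots of
`X² - 2 H_Ω X + λ_Ω K_Ω` and do not both vanish at `p`. -/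
lemma smoothExtNear_iff_and_tendsto_iff {h a b : Pt → ℝ} {p : Pt} {V : Set Pt}
    (hne : (𝓝[F.reg] p).NeBot) (hps : p ∈ F.sing) (hV : IsOpen V)
    (hVU : V ⊆ F.U) (hp : p ∈ V) (ha : ContDiffOn ℝ (⊤ : ℕ∞) a V)
    (hb : ContDiffOn ℝ (⊤ : ℕ∞) b V) (hb0 : a p = 0 → b p ≠ 0)
    (hab : ∀ q ∈ V, a q * b q = F.lam q * F.KΩ q) (hh : ∀ q ∈ F.reg, h q = a q / F.lam q) :
    (F.SmoothExtNear h p ↔ a p = 0) ∧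
      (Tendsto (fun q => |h q|) (𝓝[F.reg] p) atTop ↔ a p ≠ 0) := by
  have h1 : a p = 0 → F.SmoothExtNear h p := fun h0 =>
    F.smoothExtNear_of_mul_eq hV hVU hp hb (hb0 h0) hab hh
  have h2 : a p ≠ 0 → Tendsto (fun q => |h q|) (𝓝[F.reg] p) atTop := fun h0 =>
    F.tendsto_abs_atTop hps (ha.continuousOn.continuousAt (hV.mem_nhds hp)) h0 hh
  have h3 : F.SmoothExtNear h p → ¬ Tendsto (fun q => |h q|) (𝓝[F.reg] p) atTop :=
    SmoothExtNear.not_tendsto F hne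
  tauto

end Frontal

/-- At a rank-1 singularity of a proper wavefront, exactly one of
`k₁`, `k₂` admits a `C^∞` extension near `p`; `k_i` extends iff `k_{iΩ}(p) = 0`,
and `|k_i| → ∞` at `p` through the regular set iff `k_{iΩ}(p) ≠ 0`. -/
theorem stmt7 (F : Frontal) (hW : F.IsWavefront) (hP : F.IsProper)
    (p : Pt) (hp : p ∈ F.sing) (hr : (jac F.x p).rank = 1) :
    Xor' (F.SmoothExtNear F.k1 p) (F.SmoothExtNear F.k2 p) ∧
    (F.SmoothExtNear F.k1 p ↔ F.k1Ω p = 0) ∧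
    (F.SmoothExtNear F.k2 p ↔ F.k2Ω p = 0) ∧
    (Tendsto (fun q => |F.k1 q|) (nhdsWithin p F.reg) atTop ↔ F.k1Ω p ≠ 0) ∧
    (Tendsto (fun q => |F.k2 q|) (nhdsWithin p F.reg) atTop ↔ F.k2Ω p ≠ 0) := by
  have hne := F.nhdsWithin_reg_neBot hP hp.1
  have hH := F.HΩ_ne_zero hW hp hr
  have hd : ContDiffOn ℝ (⊤ : ℕ∞) (fun q => F.HΩ q ^ 2 - F.lam q * F.KΩ q) F.U :=
    (F.contDiffOn_HΩ.pow 2).sub (F.contDiffOn_lam.mul F.contDiffOn_KΩ)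
  set V : Set Pt := F.U ∩ (fun q => F.HΩ q ^ 2 - F.lam q * F.KΩ q) ⁻¹' Set.Ioi 0
  have hV : IsOpen V := hd.continuousOn.isOpen_inter_preimage F.isOpen_U isOpen_Ioi
  have hVU : V ⊆ F.U := Set.inter_subset_left
  have hlp : F.lam p = 0 := hp.2
  have hpV : p ∈ V := ⟨hp.1, by
    simp only [Set.mem_preimage, Set.mem_Ioi, hlp, zero_mul, sub_zero]
    positivity⟩
  have hs : ContDiffOn ℝ (⊤ : ℕ∞) (fun q => Real.sqrt (F.HΩ q ^ 2 - F.lam q * F.KΩ q)) V :=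
    (hd.mono hVU).sqrt fun q hq => ne_of_gt hq.2
  have h1 : ContDiffOn ℝ (⊤ : ℕ∞) F.k1Ω V := (F.contDiffOn_HΩ.mono hVU).sub hs
  have h2 : ContDiffOn ℝ (⊤ : ℕ∞) F.k2Ω V := (F.contDiffOn_HΩ.mono hVU).add hs
  have hmul : ∀ q ∈ V, F.k1Ω q * F.k2Ω q = F.lam q * F.KΩ q := fun q hq => by
    have := Real.sq_sqrt (le_of_lt hq.2)
    unfold Frontal.k1Ω Frontal.k2Ω
    linear_combination -this
  have hsum : F.k1Ω p + F.k2Ω p ≠ 0 := by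
    have : F.k1Ω p + F.k2Ω p = 2 * F.HΩ p := by
      unfold Frontal.k1Ω Frontal.k2Ω; ring
    rw [this]
    exact mul_ne_zero two_ne_zero hH
  have h12 : F.k1Ω p = 0 → F.k2Ω p ≠ 0 := fun h h' => hsum (by rw [h, h', add_zero])
  have h21 : F.k2Ω p = 0 → F.k1Ω p ≠ 0 := fun h h' => h12 h' h
  have hor : F.k1Ω p = 0 ∨ F.k2Ω p = 0 :=
    mul_eq_zero.1 (by rw [hmul p hpV, hlp, zero_mul])
  obtain ⟨e1, t1⟩ := F.smoothExtNear_iff_and_tendsto_iff hne hp hV hVU hpV h1 h2 h12 hmul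
    fun q => F.k1_eq
  obtain ⟨e2, t2⟩ := F.smoothExtNear_iff_and_tendsto_iff hne hp hV hVU hpV h2 h1 h21
    (fun q hq => by rw [mul_comm, hmul q hq]) fun q => F.k2_eq
  refine ⟨?_, e1, e2, t1, t2⟩
  rw [e1, e2]
  exact hor.imp (fun h => ⟨h, h12 h⟩) fun h => ⟨h, h21 h⟩
end
end
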